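/- Let S = { i/2^j : i = 1,…,2^j − 1, j ∈ ℕ } ⊂ [0,1], δ_j = (1/2)^{2j}, and define f_j : [0,1] → [1,2] by f_j(t) = h((t − s_{i,j})/δ_j) for t ∈ [s_{i,j} − δ_j, s_{i,j} + δ_j] with s_{i,j} = i/2^j, i = 1,…,2^j − 1, and f_j(t) = 2 elsewhere, where h : [−1,1] → [1,2] is continuous with h(−1) = 2, decreasing to h ≡ 1 on [−1/2, 1/2], and increasing back to h(1) = 2. Set g_j = −dt² + f_j(t)²σ and g = −dt² + 4σ on [0,1] × 𝔻ⁿ, where (𝔻ⁿ,σ) is the flat disk. Then d̂_{t,g_j} converges uniformly to the metric d₀ given by d₀(p,q) = |t(p) − t(q)| if q ∈ J^±_g(p), and d₀(p,q) = |t(p) − t(q)| + d_σ( (J^±_g(p) ∩ ({t(q)} × 𝔻ⁿ))_{𝔻ⁿ}, q_{𝔻ⁿ} ) if q ∉ J^±_g(p). Thus f_j → 1 pointwise on a dense set but d̂_{t,g_j} does not converge to the null distance of the Minkowski product −dt² + σ. -/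

import Mathlib

open Set MeasureTheory Filter Topology

namespace NullDistPaper

variable {S : Type*} [PseudoMetricSpace S]

/-- A future-directed causal piece of a curve in the warped product spacetime
`([t₀,t₁] × S, -dt² + f(t,x)² σ)`, parametrized by the time coordinate on `[a,b]`:
the spatial part `x` is continuous, and its σ-length (total variation) over any
subinterval is at most the corresponding integral of `1/f` along the curve. -/
def FutureCausalPiece (f : ℝ → S → ℝ) (x : ℝ → S) (a b : ℝ) : Prop :=
  a ≤ b ∧ ContinuousOn x (Set.Icc a b) ∧
    ∀ c ∈ Set.Icc a b, ∀ d ∈ Set.Icc a b, c ≤ d →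
      eVariationOn x (Set.Icc c d) ≤ ENNReal.ofReal (∫ t in c..d, 1 / f t (x t))

/-- `q` lies in the causal future of `p`, i.e. there is a future-directed causal
curve from `p` to `q`. -/
def FutureRelated (f : ℝ → S → ℝ) (p q : ℝ × S) : Prop :=
  p.1 ≤ q.1 ∧ ∃ x : ℝ → S, x p.1 = p.2 ∧ x q.1 = q.2 ∧ FutureCausalPiece f x p.1 q.1

/-- `q ∈ J^±(p)` : `q` is causally related to `p`. -/
def CausallyRelated (f : ℝ → S → ℝ) (p q : ℝ × S) : Prop :=
  FutureRelated f p q ∨ FutureRelated f q p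

/-- A piecewise causal curve in `[t₀,t₁] × S` from `p` to `q`, recorded by its
breakpoints; consecutive breakpoints are joined by a future- or past-directed
causal piece. -/
structure PiecewiseCausal (f : ℝ → S → ℝ) (t₀ t₁ : ℝ) (p q : ℝ × S) where
  k : ℕ
  hk : 0 < k
  pt : ℕ → ℝ × S
  h0 : pt 0 = p
  hlast : pt k = q
  hstrip : ∀ i ≤ k, (pt i).1 ∈ Set.Icc t₀ t₁
  piece : ∀ i < k, CausallyRelated f (pt i) (pt (i + 1))

/-- The null length of a piecewise causal curve with respect to the
time function `τ`. -/
noncomputable def nullLength (τ : ℝ × S → ℝ) {f : ℝ → S → ℝ} {t₀ t₁ : ℝ} {p q : ℝ × S}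
    (γ : PiecewiseCausal f t₀ t₁ p q) : ℝ :=
  ∑ i ∈ Finset.range γ.k, |τ (γ.pt (i + 1)) - τ (γ.pt i)|

/-- The null distance on `[t₀,t₁] × S` for the warped product `-dt² + f(t,x)²σ`
and the time function `τ`. -/
noncomputable def nullDist (f : ℝ → S → ℝ) (τ : ℝ × S → ℝ) (t₀ t₁ : ℝ) (p q : ℝ × S) : ℝ :=
  sInf {L : ℝ | ∃ γ : PiecewiseCausal f t₀ t₁ p q, L = nullLength τ γ}

/-- Warping function depending only on the time coordinate. -/
def tWarp (f : ℝ → ℝ) : ℝ → S → ℝ := fun t _ => f t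

/-- The metric of `S` is intrinsic (a length metric): any two points can be
joined by continuous curves of length arbitrarily close to their distance.
This encodes that `(S, d)` comes from a (continuous) Riemannian metric. -/
def IsLengthSpace (S : Type*) [PseudoMetricSpace S] : Prop :=
  ∀ x y : S, ∀ ε > 0, ∃ γ : ℝ → S, γ 0 = x ∧ γ 1 = y ∧ ContinuousOn γ (Set.Icc 0 1) ∧
    eVariationOn γ (Set.Icc 0 1) ≤ ENNReal.ofReal (dist x y + ε)

end NullDistPaper

open NullDistPaper Set Filter

namespace NullDistPaper

/-- The flat unit disk `𝔻ⁿ ⊆ ℝⁿ` (with its flat, i.e. Euclidean, metric). -/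
abbrev Disk (n : ℕ) : Type := (Metric.closedBall (0 : EuclideanSpace ℝ (Fin n)) 1 : Set _)

/-- Distance between two subsets of a metric space,
`d(A,B) = inf { d(a,b) : a ∈ A, b ∈ B }`. -/
noncomputable def setDist {S : Type*} [PseudoMetricSpace S] (A B : Set S) : ℝ :=
  sInf {r : ℝ | ∃ a ∈ A, ∃ b ∈ B, r = dist a b}

open Classical in
/-- The limit metric of the dense network of shortcuts example:
`d₀(p,q) = |t(p)-t(q)|` if `q ∈ J^±_g(p)` and
`d₀(p,q) = |t(p)-t(q)| + d_σ((J^±_g(p) ∩ ({t(q)} × 𝔻ⁿ))_{𝔻ⁿ}, q_{𝔻ⁿ})`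
otherwise, where `g = -dt² + 4σ`. -/
noncomputable def shortcutLimitDist {n : ℕ} (p q : ℝ × Disk n) : ℝ :=
  if CausallyRelated (tWarp fun _ => (2:ℝ)) p q then |p.1 - q.1|
  else |p.1 - q.1| + setDist
    {x : Disk n | CausallyRelated (tWarp fun _ => (2:ℝ)) p (q.1, x)} {q.2}

end NullDistPaper

namespace NullDistPaper

lemma disk_seg {n : ℕ} (x y : Disk n) : ∃ c : ℝ → Disk n, c 0 = x ∧ c 1 = y ∧
    ∀ s ∈ Icc (0:ℝ) 1, ∀ t ∈ Icc (0:ℝ) 1, dist (c s) (c t) = |s - t| * dist x y := by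
  classical
  have hm : ∀ s ∈ Icc (0:ℝ) 1, AffineMap.lineMap (x : EuclideanSpace ℝ (Fin n)) (y : EuclideanSpace ℝ (Fin n)) s ∈
      Metric.closedBall (0 : EuclideanSpace ℝ (Fin n)) 1 := fun s hs =>
    (convex_closedBall (0 : EuclideanSpace ℝ (Fin n)) 1).lineMap_mem x.2 y.2 hs
  refine ⟨fun s => if h : s ∈ Icc (0:ℝ) 1 then ⟨_, hm s h⟩ else x, ?_, ?_, ?_⟩
  · simp
  · simp
  · intro s hs t ht
    simp only [hs, ht, dif_pos]
    rw [Subtype.dist_eq, Subtype.dist_eq]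
    simp only [dist_lineMap_lineMap, Real.dist_eq]

lemma inv_int {f : ℝ → ℝ} (hfc : ContinuousOn f (Icc 0 1))
    (hfr : ∀ t ∈ Icc (0:ℝ) 1, 1 ≤ f t ∧ f t ≤ 2) {a b : ℝ} (ha : a ∈ Icc (0:ℝ) 1)
    (hb : b ∈ Icc (0:ℝ) 1) : IntervalIntegrable (fun t => 1 / f t) volume a b := by
  apply ContinuousOn.intervalIntegrable
  have hsub : uIcc a b ⊆ Icc (0:ℝ) 1 := Set.uIcc_subset_Icc ha hb
  apply ContinuousOn.div continuousOn_const (hfc.mono hsub)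
  intro t ht
  have := (hfr t (hsub ht)).1
  positivity

lemma dist_le_of_future {S : Type*} [PseudoMetricSpace S] {f : ℝ → ℝ} {p q : ℝ × S}
    (h : FutureRelated (tWarp f) p q) (h0 : 0 ≤ ∫ t in p.1..q.1, 1 / f t) :
    dist p.2 q.2 ≤ ∫ t in p.1..q.1, 1 / f t := by
  obtain ⟨hle, x, hx1, hx2, -, -, hv⟩ := h
  have h1 := hv p.1 (left_mem_Icc.2 hle) q.1 (right_mem_Icc.2 hle) hle
  have h2 := (eVariationOn.edist_le x (left_mem_Icc.2 hle) (right_mem_Icc.2 hle)).trans h1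
  rw [hx1, hx2, edist_dist] at h2
  exact (ENNReal.ofReal_le_ofReal_iff h0).1 h2

lemma future_of_dist {n : ℕ} {f : ℝ → ℝ} {p q : ℝ × Disk n} (v : ℝ) (hv : 0 ≤ v) (hle : p.1 ≤ q.1)
    (hint : IntervalIntegrable (fun t => 1 / f t) volume p.1 q.1)
    (hfv : ∀ t ∈ Icc p.1 q.1, v ≤ 1 / f t)
    (hd : dist p.2 q.2 ≤ v * (q.1 - p.1)) : FutureRelated (tWarp f) p q := by
  obtain ⟨c, hc0, hc1, hc⟩ := disk_seg p.2 q.2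
  rcases hle.eq_or_lt with heq | hlt
  · have : p.2 = q.2 := by
      rw [← dist_le_zero]; rw [heq] at hd; simpa using hd
    refine ⟨hle, fun _ => p.2, rfl, this, hle, continuousOn_const, ?_⟩
    intro c _ d _ _
    rw [eVariationOn.constant_on]
    · exact zero_le
    · intro a ha b hb
      obtain ⟨_, _, rfl⟩ := ha
      obtain ⟨_, _, rfl⟩ := hb
      rfl
  · have hpos : 0 < q.1 - p.1 := sub_pos.2 hlt
    have hmem : ∀ t ∈ Icc p.1 q.1, (t - p.1) / (q.1 - p.1) ∈ Icc (0:ℝ) 1 := by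
      intro t ht
      exact ⟨div_nonneg (by linarith [ht.1]) hpos.le, (div_le_one hpos).2 (by linarith [ht.2])⟩
    have hL : LipschitzOnWith (Real.toNNReal v) (fun t => c ((t - p.1) / (q.1 - p.1)))
        (Icc p.1 q.1) := by
      apply LipschitzOnWith.of_dist_le_mul
      intro s hs t ht
      rw [hc _ (hmem s hs) _ (hmem t ht), Real.coe_toNNReal v hv, Real.dist_eq, ← sub_div,
        abs_div, abs_of_pos hpos, sub_sub_sub_cancel_right, div_mul_eq_mul_div,
        div_le_iff₀ hpos]
      nlinarith [abs_nonneg (s - t)]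
    refine ⟨hle, fun t => c ((t - p.1) / (q.1 - p.1)), by simpa using hc0, ?_, hle,
      hL.continuousOn, ?_⟩
    · simp only [div_self hpos.ne', hc1]
    · intro a ha b hb hab
      have hsub : Icc a b ⊆ Icc p.1 q.1 := Icc_subset_Icc ha.1 hb.2
      have h1 := LipschitzOnWith.comp_eVariationOn_le (hL.mono hsub) (g := id) (s := Icc a b)
        (fun x hx => hx)
      have h2 : eVariationOn (id : ℝ → ℝ) (Icc a b) ≤ ENNReal.ofReal (b - a) := by
        have := (monotoneOn_id (s := Icc a b)).eVariationOn_le (left_mem_Icc.2 hab)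
          (right_mem_Icc.2 hab)
        simpa using this
      refine (h1.trans (mul_le_mul_right h2 _)).trans ?_
      change ENNReal.ofReal v * _ ≤ _
      rw [← ENNReal.ofReal_mul hv]
      apply ENNReal.ofReal_le_ofReal
      change _ ≤ ∫ t in a..b, 1 / f t
      have : ∫ t in a..b, v ≤ ∫ t in a..b, 1 / f t := by
        apply intervalIntegral.integral_mono_on hab (by simp)
        · apply hint.mono_set
          rw [uIcc_of_le hab, uIcc_of_le hle]; exact hsub
        · intro t ht; exact hfv t (hsub ht)
      simpa [mul_comm] using this

lemma causal_of_dist {n : ℕ} {f : ℝ → ℝ} {p q : ℝ × Disk n} (v : ℝ) (hv : 0 ≤ v)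
    (hint : IntervalIntegrable (fun t => 1 / f t) volume p.1 q.1)
    (hfv : ∀ t ∈ uIcc p.1 q.1, v ≤ 1 / f t)
    (hd : dist p.2 q.2 ≤ v * |p.1 - q.1|) : CausallyRelated (tWarp f) p q := by
  rcases le_total p.1 q.1 with h | h
  · left
    rw [uIcc_of_le h] at hfv
    rw [abs_sub_comm, abs_of_nonneg (sub_nonneg.2 h)] at hd
    exact future_of_dist v hv h hint hfv hd
  · right
    rw [uIcc_of_ge h] at hfv
    rw [abs_of_nonneg (sub_nonneg.2 h), dist_comm] at hd
    exact future_of_dist v hv h hint.symm hfv hd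

lemma causal_two_iff {n : ℕ} {p q : ℝ × Disk n} :
    CausallyRelated (tWarp fun _ => (2:ℝ)) p q ↔ dist p.2 q.2 ≤ |p.1 - q.1| / 2 := by
  constructor
  · have key : ∀ p q : ℝ × Disk n, FutureRelated (tWarp fun _ => (2:ℝ)) p q →
        dist p.2 q.2 ≤ |p.1 - q.1| / 2 := by
      intro p q h
      have hle := h.1
      have := dist_le_of_future h (by simp; linarith)
      simp at this
      rw [abs_sub_comm, abs_of_nonneg (sub_nonneg.2 hle)]; linarith
    rintro (h | h)
    · exact key _ _ h
    · rw [dist_comm, abs_sub_comm]; exact key _ _ h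
  · intro h
    exact causal_of_dist (1/2) (by norm_num) (by simp) (by intros; norm_num) (by linarith)

lemma disk_point {n : ℕ} (x y : Disk n) (r : ℝ) (h0 : 0 ≤ r) (h1 : r ≤ dist x y) :
    ∃ z : Disk n, dist x z = r ∧ dist z y = dist x y - r := by
  obtain ⟨c, hc0, hc1, hc⟩ := disk_seg x y
  rcases h0.eq_or_lt with rfl | hr
  · exact ⟨x, by simp, by simp⟩
  · have hD : 0 < dist x y := hr.trans_le h1
    have hm : r / dist x y ∈ Icc (0:ℝ) 1 := ⟨by positivity, (div_le_one hD).2 h1⟩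
    refine ⟨c (r / dist x y), ?_, ?_⟩
    · have h := hc 0 (by simp) _ hm
      rw [hc0] at h
      rw [h, zero_sub, abs_neg, abs_of_nonneg hm.1]; field_simp
    · have h := hc _ hm 1 (by simp)
      rw [hc1] at h
      rw [h, abs_sub_comm, abs_of_nonneg (sub_nonneg.2 hm.2)]; field_simp

lemma limitDist_eq {n : ℕ} (p q : ℝ × Disk n) :
    shortcutLimitDist p q = max |p.1 - q.1| (dist p.2 q.2 + |p.1 - q.1| / 2) := by
  unfold shortcutLimitDist
  split_ifs with h
  · rw [causal_two_iff] at h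
    rw [max_eq_left]; linarith
  · rw [causal_two_iff] at h
    push Not at h
    rw [max_eq_right (by linarith)]
    have : setDist {x : Disk n | CausallyRelated (tWarp fun _ => (2:ℝ)) p (q.1, x)} {q.2}
        = dist p.2 q.2 - |p.1 - q.1| / 2 := by
      unfold setDist
      apply IsLeast.csInf_eq
      constructor
      · obtain ⟨z, hz1, hz2⟩ := disk_point p.2 q.2 (|p.1 - q.1| / 2) (by positivity) h.le
        refine ⟨z, ?_, q.2, rfl, hz2.symm⟩
        rw [mem_setOf_eq, causal_two_iff]; exact hz1.le
      · rintro r ⟨a, ha, b, rfl, rfl⟩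
        rw [mem_setOf_eq, causal_two_iff] at ha
        simp only at ha
        linarith [dist_triangle p.2 a q.2]
    rw [this]; ring

/-- Existence of a piecewise causal curve of given null length. -/
inductive Chain {S : Type*} [PseudoMetricSpace S] (f : ℝ → S → ℝ) (p : ℝ × S) : ℝ × S → ℝ → Prop
  | refl : p.1 ∈ Icc (0:ℝ) 1 → Chain f p p 0
  | step {q r : ℝ × S} {L : ℝ} : Chain f p q L → CausallyRelated f q r → r.1 ∈ Icc (0:ℝ) 1 →
      Chain f p r (L + |r.1 - q.1|)

lemma Chain.trans {S : Type*} [PseudoMetricSpace S] {f : ℝ → S → ℝ} {p q r : ℝ × S} {L M : ℝ}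
    (h : Chain f p q L) (h' : Chain f q r M) : Chain f p r (L + M) := by
  induction h' with
  | refl _ => simpa using h
  | step _ hc hr ih => rw [← add_assoc]; exact ih.step hc hr

lemma Chain.exists_pts {S : Type*} [PseudoMetricSpace S] {f : ℝ → S → ℝ} {p q : ℝ × S} {L : ℝ}
    (h : Chain f p q L) : ∃ (k : ℕ) (pt : ℕ → ℝ × S), pt 0 = p ∧ pt k = q ∧
      (∀ i ≤ k, (pt i).1 ∈ Icc (0:ℝ) 1) ∧ (∀ i < k, CausallyRelated f (pt i) (pt (i+1))) ∧
      L = ∑ i ∈ Finset.range k, |(pt (i + 1)).1 - (pt i).1| := by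
  induction h with
  | refl hp => exact ⟨0, fun _ => p, rfl, rfl, fun _ _ => hp, by simp, by simp⟩
  | @step q r L _ hc hr ih =>
    obtain ⟨k, pt, h0, hk, hs, hp, hL⟩ := ih
    refine ⟨k + 1, fun i => if i ≤ k then pt i else r, by simp [h0], by simp, ?_, ?_, ?_⟩
    · intro i hi
      by_cases h : i ≤ k
      · simpa [h] using hs i h
      · simpa [h] using hr
    · intro i hi
      by_cases h : i < k
      · have h1 : i ≤ k := h.le
        have h2 : i + 1 ≤ k := h
        simpa [h1, h2] using hp i h
      · obtain rfl : i = k := by omega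
        simpa [hk] using hc
    · rw [Finset.sum_range_succ, hL]
      congr 1
      · apply Finset.sum_congr rfl
        intro i hi
        have h := Finset.mem_range.1 hi
        have h1 : i ≤ k := h.le
        have h2 : i + 1 ≤ k := h
        simp [h1, h2]
      · simp [hk]

lemma nullLength_nonneg {S : Type*} [PseudoMetricSpace S] {τ : ℝ × S → ℝ} {f : ℝ → S → ℝ}
    {p q : ℝ × S} (γ : PiecewiseCausal f 0 1 p q) : 0 ≤ nullLength τ γ :=
  Finset.sum_nonneg fun _ _ => abs_nonneg _

lemma Chain.exists_curve {S : Type*} [PseudoMetricSpace S] {f : ℝ → S → ℝ} {p q r : ℝ × S} {L : ℝ}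
    (h : Chain f p r L) (hc : CausallyRelated f r q) (hq : q.1 ∈ Icc (0:ℝ) 1) :
    ∃ γ : PiecewiseCausal f 0 1 p q, L + |q.1 - r.1| = nullLength (fun p => p.1) γ := by
  obtain ⟨k, pt, h0, hk, hs, hp, hL⟩ := h.exists_pts
  refine ⟨⟨k + 1, by omega, fun i => if i ≤ k then pt i else q, by simp [h0], by simp, ?_, ?_⟩, ?_⟩
  · intro i hi
    by_cases h : i ≤ k
    · simpa [h] using hs i h
    · simpa [h] using hq
  · intro i hi
    by_cases h : i < k
    · have h1 : i ≤ k := h.le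
      have h2 : i + 1 ≤ k := h
      simpa [h1, h2] using hp i h
    · obtain rfl : i = k := by omega
      simpa [hk] using hc
  · unfold nullLength
    simp only
    rw [Finset.sum_range_succ, hL]
    congr 1
    · apply Finset.sum_congr rfl
      intro i hi
      have h := Finset.mem_range.1 hi
      have h1 : i ≤ k := h.le
      have h2 : i + 1 ≤ k := h
      simp [h1, h2]
    · simp [hk]

lemma nullDist_le {S : Type*} [PseudoMetricSpace S] {f : ℝ → S → ℝ} {p q : ℝ × S}
    (γ : PiecewiseCausal f 0 1 p q) :
    nullDist f (fun p => p.1) 0 1 p q ≤ nullLength (fun p => p.1) γ := by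
  apply csInf_le
  · exact ⟨0, by rintro _ ⟨γ, rfl⟩; exact nullLength_nonneg γ⟩
  · exact ⟨γ, rfl⟩

/-- Lower bound. -/
lemma lower {n : ℕ} {f : ℝ → ℝ} (hfc : ContinuousOn f (Icc 0 1))
    (hfr : ∀ t ∈ Icc (0:ℝ) 1, 1 ≤ f t ∧ f t ≤ 2) (η : ℝ)
    (hη : ∀ a ∈ Icc (0:ℝ) 1, ∀ b ∈ Icc (0:ℝ) 1, a ≤ b → ∫ t in a..b, 1 / f t ≤ (b - a) / 2 + η)
    {p q : ℝ × Disk n} (γ : PiecewiseCausal (tWarp f) 0 1 p q) :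
    max |p.1 - q.1| (dist p.2 q.2 + |p.1 - q.1| / 2) - η ≤ nullLength (fun p => p.1) γ := by
  have hη0 : 0 ≤ η := by simpa using hη 0 (by simp) 0 (by simp) le_rfl
  obtain ⟨k, hk, pt, h0, hl, hs, hp⟩ := γ
  unfold nullLength
  simp only
  set L := ∑ i ∈ Finset.range k, |(pt (i + 1)).1 - (pt i).1| with hLdef
  have hp1 : p.1 ∈ Icc (0:ℝ) 1 := by rw [← h0]; exact hs 0 (by omega)
  have hq1 : q.1 ∈ Icc (0:ℝ) 1 := by rw [← hl]; exact hs k le_rfl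
  have hA : |p.1 - q.1| ≤ L := by
    have := dist_le_range_sum_dist (fun i => (pt i).1) k
    simp only [Real.dist_eq, h0, hl] at this
    refine this.trans (Finset.sum_le_sum fun i _ => (abs_sub_comm _ _).le)
  have hfi : ∀ {a b : ℝ}, a ∈ Icc (0:ℝ) 1 → b ∈ Icc (0:ℝ) 1 →
    IntervalIntegrable (fun t => 1 / f t) volume a b := fun ha hb => inv_int hfc hfr ha hb
  set F : ℝ → ℝ := fun x => ∫ t in (0:ℝ)..x, 1 / f t with hF
  have hFd : ∀ a ∈ Icc (0:ℝ) 1, ∀ b ∈ Icc (0:ℝ) 1, ∫ t in a..b, 1 / f t = F b - F a := by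
    intro a ha b hb
    rw [hF]
    simp only
    rw [intervalIntegral.integral_interval_sub_left (hfi (by simp) hb) (hfi (by simp) ha)]
  have hF0 : ∀ a ∈ Icc (0:ℝ) 1, ∀ b ∈ Icc (0:ℝ) 1, a ≤ b → 0 ≤ F b - F a ∧ F b - F a ≤ b - a := by
    intro a ha b hb hab
    rw [← hFd a ha b hb]
    constructor
    · apply intervalIntegral.integral_nonneg hab
      intro t ht
      have := (hfr t ⟨ha.1.trans ht.1, ht.2.trans hb.2⟩).1
      positivity
    · have : ∫ t in a..b, 1 / f t ≤ ∫ t in a..b, (1:ℝ) := by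
        apply intervalIntegral.integral_mono_on hab (hfi ha hb) (by simp)
        intro t ht
        have := (hfr t ⟨ha.1.trans ht.1, ht.2.trans hb.2⟩).1
        rw [div_le_one (by linarith)]; exact this
      simpa using this
  have key : ∀ p q : ℝ × Disk n, p.1 ∈ Icc (0:ℝ) 1 → q.1 ∈ Icc (0:ℝ) 1 →
      FutureRelated (tWarp f) p q →
      dist p.2 q.2 ≤ |q.1 - p.1| - |(p.1 - F p.1) - (q.1 - F q.1)| := by
    intro p q hp hq h
    have h1 := hF0 _ hp _ hq h.1
    have h2 := dist_le_of_future h (by rw [hFd _ hp _ hq]; exact h1.1)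
    rw [hFd _ hp _ hq] at h2
    have := h.1
    rw [abs_of_nonneg (by linarith), abs_of_nonpos (by linarith)]
    linarith
  have hpiece : ∀ i ∈ Finset.range k, dist (pt i).2 (pt (i+1)).2 ≤
      |(pt (i + 1)).1 - (pt i).1| -
        dist ((pt i).1 - F (pt i).1) ((pt (i+1)).1 - F (pt (i+1)).1) := by
    intro i hi
    have hi' := Finset.mem_range.1 hi
    rw [Real.dist_eq]
    rcases hp i hi' with h | h
    · exact key _ _ (hs i hi'.le) (hs (i+1) hi') h
    · rw [dist_comm, abs_sub_comm (pt (i+1)).1, abs_sub_comm ((pt i).1 - F (pt i).1)]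
      exact key _ _ (hs (i+1) hi') (hs i hi'.le) h
  have hsum := Finset.sum_le_sum hpiece
  rw [Finset.sum_sub_distrib] at hsum
  have hd := dist_le_range_sum_dist (fun i => (pt i).2) k
  have hd2 := dist_le_range_sum_dist (fun i => (pt i).1 - F (pt i).1) k
  simp only [h0, hl] at hd hd2
  have hlast : |p.1 - q.1| / 2 - η ≤ dist (p.1 - F p.1) (q.1 - F q.1) := by
    rw [Real.dist_eq]
    rcases le_total p.1 q.1 with h | h
    · have := hη _ hp1 _ hq1 h
      rw [hFd _ hp1 _ hq1] at this
      rw [abs_of_nonpos (by linarith : p.1 - q.1 ≤ 0)]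
      refine le_trans ?_ (neg_le_abs _)
      linarith
    · have := hη _ hq1 _ hp1 h
      rw [hFd _ hq1 _ hp1] at this
      rw [abs_of_nonneg (by linarith : 0 ≤ p.1 - q.1)]
      refine le_trans ?_ (le_abs_self _)
      linarith
  rw [sub_le_iff_le_add]
  apply max_le <;> linarith

lemma zigzag {n : ℕ} {f : ℝ → ℝ} (hfc : ContinuousOn f (Icc 0 1))
    (hfr : ∀ t ∈ Icc (0:ℝ) 1, 1 ≤ f t ∧ f t ≤ 2) (s w : ℝ) (hw : 0 < w)
    (hs : s ∈ Icc (0:ℝ) 1) (hs' : s + w ∈ Icc (0:ℝ) 1)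
    (hf1 : ∀ t ∈ Icc s (s + w), f t = 1) (x y : Disk n) :
    Chain (tWarp f) (s, x) (s, y) (dist x y) := by
  obtain ⟨c, hc0, hc1, hc⟩ := disk_seg x y
  obtain ⟨m, hm⟩ := exists_nat_gt (dist x y / w)
  have hm0 : (0:ℝ) < m := (div_nonneg dist_nonneg hw.le).trans_lt hm
  have hdm : dist x y < m * w := (div_lt_iff₀ hw).1 hm
  set h : ℝ := dist x y / (2 * m) with hh
  have hh0 : 0 ≤ h := by positivity
  have hhw : h ≤ w := by
    rw [hh, div_le_iff₀ (by positivity)]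
    nlinarith
  have hsh : s + h ∈ Icc (0:ℝ) 1 := ⟨by linarith [hs.1], by linarith [hs'.2]⟩
  have hcausal : ∀ z z' : Disk n, dist z z' ≤ h → CausallyRelated (tWarp f) (s, z) (s + h, z') := by
    intro z z' hz
    refine causal_of_dist 1 (by norm_num) (inv_int hfc hfr hs hsh) ?_ ?_
    · intro t ht
      simp only at ht
      rw [uIcc_of_le (by linarith)] at ht
      rw [hf1 t ⟨ht.1, by linarith [ht.2]⟩]; norm_num
    · simpa [abs_of_nonneg hh0] using hz
  have hstep : ∀ i : ℕ, i ≤ m →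
      Chain (tWarp f) (s, x) (s, c (i / m)) (i * (2 * h)) := by
    intro i
    induction i with
    | zero => intro _; simpa [hc0] using Chain.refl (f := tWarp f) (p := (s, x)) hs
    | succ i ih =>
      intro hi
      have hi' : ((i:ℝ) + 1) ≤ m := by exact_mod_cast hi
      have hi0 : (0:ℝ) ≤ i := by positivity
      have h1 := ih (by omega)
      have m1 : (i / m : ℝ) ∈ Icc (0:ℝ) 1 := ⟨by positivity, (div_le_one hm0).2 (by linarith)⟩
      have m2 : ((i + 1/2) / m : ℝ) ∈ Icc (0:ℝ) 1 := ⟨by positivity, (div_le_one hm0).2 (by linarith)⟩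
      have m3 : ((i + 1) / m : ℝ) ∈ Icc (0:ℝ) 1 := ⟨by positivity, (div_le_one hm0).2 (by linarith)⟩
      have h2 := h1.step (hcausal _ (c ((i + 1/2) / m)) (by
        rw [hc _ m1 _ m2, ← sub_div, abs_div, abs_of_pos hm0, abs_of_nonpos (by linarith), hh]
        apply le_of_eq; field_simp; ring)) hsh
      have h3 := h2.step (Or.symm (hcausal (c ((i + 1) / m)) (c ((i + 1/2) / m)) (by
        rw [hc _ m3 _ m2, ← sub_div, abs_div, abs_of_pos hm0, abs_of_nonneg (by linarith), hh]
        apply le_of_eq; field_simp; ring))) hs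
      simp only at h3
      rw [add_sub_cancel_left, sub_add_cancel_left, abs_neg, abs_of_nonneg hh0] at h3
      push_cast
      convert h3 using 1
      ring
  have := hstep m le_rfl
  rw [div_self hm0.ne', hc1] at this
  convert this using 1
  rw [hh]; field_simp

/-- Upper bound. -/
lemma upper {n : ℕ} {f : ℝ → ℝ} (hfc : ContinuousOn f (Icc 0 1))
    (hfr : ∀ t ∈ Icc (0:ℝ) 1, 1 ≤ f t ∧ f t ≤ 2) (η : ℝ)
    (p q : ℝ × Disk n) (hp : p.1 ∈ Icc (0:ℝ) 1) (hq : q.1 ∈ Icc (0:ℝ) 1)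
    (s w : ℝ) (hw : 0 < w)
    (hs : s ∈ Icc (0:ℝ) 1) (hs' : s + w ∈ Icc (0:ℝ) 1)
    (hf1 : ∀ t ∈ Icc s (s + w), f t = 1) (hsη : |s - p.1| ≤ η) :
    ∃ γ : PiecewiseCausal (tWarp f) 0 1 p q,
     nullLength (fun p => p.1) γ ≤ max |p.1 - q.1| (dist p.2 q.2 + |p.1 - q.1| / 2) + 2 * η := by
  have hη0 : 0 ≤ η := (abs_nonneg _).trans hsη
  have hcausal : ∀ p q : ℝ × Disk n, p.1 ∈ Icc (0:ℝ) 1 → q.1 ∈ Icc (0:ℝ) 1 →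
      dist p.2 q.2 ≤ |p.1 - q.1| / 2 → CausallyRelated (tWarp f) p q := by
    intro p q hp hq h
    refine causal_of_dist (1/2) (by norm_num) (inv_int hfc hfr hp hq) ?_ (by linarith)
    intro t ht
    have := hfr t (uIcc_subset_Icc hp hq ht)
    exact one_div_le_one_div_of_le (by linarith) this.2
  by_cases hD : dist p.2 q.2 ≤ |p.1 - q.1| / 2
  · obtain ⟨γ, hγ⟩ := (Chain.refl (f := tWarp f) hp).exists_curve (hcausal p q hp hq hD) hq
    refine ⟨γ, ?_⟩
    rw [← hγ, zero_add, abs_sub_comm]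
    linarith [le_max_left |p.1 - q.1| (dist p.2 q.2 + |p.1 - q.1| / 2)]
  · push Not at hD
    obtain ⟨y, hy1, hy2⟩ := disk_point p.2 q.2 (dist p.2 q.2 - |p.1 - q.1| / 2) (by linarith)
      (by linarith [abs_nonneg (p.1 - q.1)])
    have c1 := (Chain.refl (f := tWarp f) hp).step (hcausal p (s, p.2) hp hs (by rw [dist_self]; positivity)) hs
    have c2 := c1.trans (zigzag hfc hfr s w hw hs hs' hf1 p.2 y)
    have c3 := c2.step (hcausal (s, y) (p.1, y) hs hp (by rw [dist_self]; positivity)) hp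
    obtain ⟨γ, hγ⟩ := c3.exists_curve (hcausal (p.1, y) q hp hq (by simp only; linarith)) hq
    refine ⟨γ, ?_⟩
    rw [← hγ]
    simp only
    rw [hy1, abs_sub_comm p.1 s, abs_sub_comm q.1 p.1]
    linarith [le_max_right |p.1 - q.1| (dist p.2 q.2 + |p.1 - q.1| / 2)]

lemma shortcut_near (j : ℕ) (hj : 1 ≤ j) (t : ℝ) (ht : t ∈ Icc (0:ℝ) 1) :
    ∃ i : ℕ, 1 ≤ i ∧ i ≤ 2 ^ j - 1 ∧ |(i:ℝ) / 2 ^ j - t| ≤ (1 / 2 : ℝ) ^ j := by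
  have h2 : (2:ℕ) ≤ 2 ^ j := by
    calc 2 = 2 ^ 1 := rfl
      _ ≤ 2 ^ j := Nat.pow_le_pow_right (by norm_num) hj
  have hpos : (0:ℝ) < 2 ^ j := by positivity
  have key : ∀ i : ℕ, |(i:ℝ) - t * 2 ^ j| ≤ 1 → |(i:ℝ) / 2 ^ j - t| ≤ (1 / 2 : ℝ) ^ j := by
    intro i h
    have e : (i:ℝ) / 2 ^ j - t = ((i:ℝ) - t * 2 ^ j) / 2 ^ j := by field_simp
    rw [e, abs_div, abs_of_pos hpos, one_div_pow]
    gcongr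
  have ht0 : 0 ≤ t * 2 ^ j := mul_nonneg ht.1 hpos.le
  have ht1 : t * 2 ^ j ≤ 2 ^ j := by nlinarith [ht.2]
  by_cases h1 : t * 2 ^ j < 1
  · refine ⟨1, le_rfl, by omega, key _ ?_⟩
    rw [abs_le]; push_cast; constructor <;> linarith
  · push Not at h1
    by_cases h3 : t * 2 ^ j < 2 ^ j
    · have a := Nat.floor_le ht0
      have b := Nat.lt_floor_add_one (t * 2 ^ j)
      refine ⟨⌊t * 2 ^ j⌋₊, Nat.le_floor (by simpa using h1), ?_, key _ ?_⟩
      · have : (⌊t * 2 ^ j⌋₊ : ℝ) < ((2 ^ j : ℕ) : ℝ) := by push_cast; linarith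
        have := Nat.cast_lt.1 this
        omega
      · rw [abs_le]; constructor <;> linarith
    · push Not at h3
      refine ⟨2 ^ j - 1, by omega, le_rfl, key _ ?_⟩
      rw [Nat.cast_sub (by omega)]
      rw [abs_le]; push_cast; constructor <;> linarith

lemma integral_small (j : ℕ) (d : ℝ) (hd : d = (1 / 2 : ℝ) ^ (2 * j)) {f : ℝ → ℝ}
    (hfc : ContinuousOn f (Icc 0 1))
    (hfr : ∀ t ∈ Icc (0:ℝ) 1, 1 ≤ f t ∧ f t ≤ 2)
    (hfout : ∀ t ∈ Icc (0:ℝ) 1,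
      (∀ i : ℕ, 1 ≤ i → i ≤ 2 ^ j - 1 → d ≤ |t - (i : ℝ) / 2 ^ j|) → f t = 2)
    (a : ℝ) (ha : a ∈ Icc (0:ℝ) 1) (b : ℝ) (hb : b ∈ Icc (0:ℝ) 1) (hab : a ≤ b) :
    ∫ t in a..b, 1 / f t ≤ (b - a) / 2 + (1 / 2 : ℝ) ^ j := by
  have hd0 : 0 < d := by rw [hd]; positivity
  set A : Set ℝ := ⋃ i ∈ Finset.range (2 ^ j), Icc ((i:ℝ) / 2 ^ j - d) ((i:ℝ) / 2 ^ j + d) with hA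
  have hAm : MeasurableSet A := by
    apply Finset.measurableSet_biUnion; intro i _; exact measurableSet_Icc
  have hvol : volume A ≤ ENNReal.ofReal (2 * (1/2:ℝ) ^ j) := by
    refine (measure_biUnion_finset_le _ _).trans ?_
    simp only [Real.volume_Icc, Finset.sum_const, Finset.card_range]
    have e : ∀ i : ℕ, ENNReal.ofReal ((i:ℝ) / 2 ^ j + d - ((i:ℝ) / 2 ^ j - d)) = ENNReal.ofReal (2 * d) := by
      intro i; congr 1; ring
    simp only [e, Finset.sum_const, Finset.card_range, nsmul_eq_mul]
    rw [← ENNReal.ofReal_natCast, ← ENNReal.ofReal_mul (by positivity)]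
    apply ENNReal.ofReal_le_ofReal
    rw [hd]
    push_cast
    apply le_of_eq
    rw [two_mul j, pow_add]
    have : (2:ℝ) ^ j * (1/2) ^ j = 1 := by rw [← mul_pow]; norm_num
    linear_combination (2 * (1/2:ℝ) ^ j) * this
  have hfin : volume A ≠ ⊤ := ne_top_of_le_ne_top ENNReal.ofReal_ne_top hvol
  have hind : Integrable (A.indicator (fun _ => (1/2:ℝ))) volume := by
    rw [integrable_indicator_iff hAm]
    exact integrableOn_const hfin
  have hbd : ∫ t in a..b, 1 / f t ≤ ∫ t in a..b, (1/2 + A.indicator (fun _ => (1/2:ℝ)) t) := by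
    apply intervalIntegral.integral_mono_on hab (inv_int hfc hfr ha hb)
    · exact (by simp : IntervalIntegrable (fun _ => (1/2:ℝ)) volume a b).add hind.intervalIntegrable
    · intro t ht
      have ht' : t ∈ Icc (0:ℝ) 1 := ⟨ha.1.trans ht.1, ht.2.trans hb.2⟩
      have h1 := (hfr t ht').1
      by_cases htA : t ∈ A
      · rw [indicator_of_mem htA, div_le_iff₀ (by linarith)]; linarith
      · rw [indicator_of_notMem htA, hfout t ht']
        · norm_num
        · intro i hi1 hi2
          by_contra hcon
          push Not at hcon
          apply htA
          rw [hA, mem_iUnion₂]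
          refine ⟨i, Finset.mem_range.2 (by have := Nat.one_le_two_pow (n := j); omega), ?_⟩
          have := abs_lt.1 hcon
          constructor <;> linarith
  refine hbd.trans ?_
  rw [intervalIntegral.integral_add (by simp) hind.intervalIntegrable]
  have : ∫ t in a..b, A.indicator (fun _ => (1/2:ℝ)) t ≤ (1/2:ℝ)^j := by
    rw [intervalIntegral.integral_of_le hab]
    refine (setIntegral_le_integral hind ?_).trans ?_
    · filter_upwards with t
      exact indicator_nonneg (fun _ _ => by norm_num) t
    · rw [integral_indicator hAm]
      simp only [setIntegral_const, smul_eq_mul]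
      have := ENNReal.toReal_le_of_le_ofReal (by positivity) hvol
      rw [Measure.real]
      linarith
  simp only [intervalIntegral.integral_const, smul_eq_mul]
  linarith

end NullDistPaper

/-- **Example 3.4 (`Ex-ManyShortcutTaxi`): a dense network of shortcuts.**
With `δⱼ = (1/2)^{2j}` and the dyadic points `s_{i,j} = i/2ʲ`, `i = 1,…,2ʲ-1`,
let `fⱼ : [0,1] → [1,2]` equal `2` outside the `δⱼ`-neighbourhoods of the
`s_{i,j}`, equal `1` on the middle halves, decreasing/increasing in between.
With `gⱼ = -dt² + fⱼ(t)²σ` and `g = -dt² + 4σ` on `[0,1] × 𝔻ⁿ`, the null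
distances `d̂_{t,gⱼ}` converge uniformly to the metric `d₀` defined from the
causal structure of `g`.  Thus `fⱼ → 1` pointwise on the dense set of dyadic
times, but `d̂_{t,gⱼ}` does not converge to the null distance of the Minkowski
product `-dt² + σ`. -/
theorem nullDist_dense_shortcuts
    (n : ℕ) (hn : 1 ≤ n)
    (δ : ℕ → ℝ) (hδ : ∀ j, δ j = (1 / 2 : ℝ) ^ (2 * j))
    (f : ℕ → ℝ → ℝ)
    (hfc : ∀ j : ℕ, 1 ≤ j → ContinuousOn (f j) (Set.Icc 0 1))
    (hfrange : ∀ j : ℕ, 1 ≤ j → ∀ t ∈ Set.Icc (0:ℝ) 1, 1 ≤ f j t ∧ f j t ≤ 2)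
    (hfout : ∀ j : ℕ, 1 ≤ j → ∀ t ∈ Set.Icc (0:ℝ) 1,
      (∀ i : ℕ, 1 ≤ i → i ≤ 2 ^ j - 1 → δ j ≤ |t - (i : ℝ) / 2 ^ j|) → f j t = 2)
    (hfmid : ∀ j : ℕ, 1 ≤ j → ∀ i : ℕ, 1 ≤ i → i ≤ 2 ^ j - 1 →
      ∀ t ∈ Set.Icc (0:ℝ) 1, |t - (i : ℝ) / 2 ^ j| ≤ δ j / 2 → f j t = 1)
    (hfshape : ∀ j : ℕ, 1 ≤ j → ∀ i : ℕ, 1 ≤ i → i ≤ 2 ^ j - 1 →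
      AntitoneOn (f j) (Set.Icc ((i : ℝ) / 2 ^ j - δ j) ((i : ℝ) / 2 ^ j - δ j / 2)) ∧
      MonotoneOn (f j) (Set.Icc ((i : ℝ) / 2 ^ j + δ j / 2) ((i : ℝ) / 2 ^ j + δ j))) :
    -- uniform convergence `d̂_{t,gⱼ} → d₀`:
    (∀ ε > 0, ∃ N : ℕ, ∀ j ≥ N, ∀ p q : ℝ × Disk n,
      p.1 ∈ Set.Icc (0:ℝ) 1 → q.1 ∈ Set.Icc (0:ℝ) 1 →
      |nullDist (tWarp (f j)) (fun p => p.1) 0 1 p q - shortcutLimitDist p q| ≤ ε) ∧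
    -- `fⱼ → 1` pointwise on the dense set of dyadic points:
    (∀ i m : ℕ, 1 ≤ i → i ≤ 2 ^ m - 1 →
      Tendsto (fun j => f j ((i : ℝ) / 2 ^ m)) atTop (nhds 1)) ∧
    -- but the limit `d₀` is not the null distance of the Minkowski product:
    (∃ p q : ℝ × Disk n, p.1 ∈ Set.Icc (0:ℝ) 1 ∧ q.1 ∈ Set.Icc (0:ℝ) 1 ∧
      shortcutLimitDist p q ≠
        nullDist (tWarp fun _ => (1:ℝ)) (fun p => p.1) 0 1 p q) := by
  have hd1 : ∀ j : ℕ, δ j ≤ (1/2:ℝ) ^ j := by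
    intro j
    rw [hδ]
    exact pow_le_pow_of_le_one (by norm_num) (by norm_num) (by omega)
  have hdp : ∀ j : ℕ, 0 < δ j := by intro j; rw [hδ]; positivity
  refine ⟨?_, ?_, ?_⟩
  · intro ε hε
    obtain ⟨N, hN⟩ := exists_pow_lt_of_lt_one (show 0 < ε / 2 by linarith)
      (show (1/2:ℝ) < 1 by norm_num)
    refine ⟨N + 1, fun j hj p q hp hq => ?_⟩
    have hj1 : 1 ≤ j := by omega
    have hjε : (1/2:ℝ) ^ j < ε / 2 :=
      (pow_le_pow_of_le_one (by norm_num) (by norm_num) (by omega)).trans_lt hN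
    obtain ⟨i, hi1, hi2, hi⟩ := shortcut_near j hj1 p.1 hp
    have hpow : (0:ℝ) < 2 ^ j := by positivity
    have hη0 : (0:ℝ) < (1/2) ^ j := by positivity
    have hi0 : (0:ℝ) ≤ (i:ℝ) / 2 ^ j := by positivity
    have hile : (i:ℝ) / 2 ^ j + (1/2) ^ j ≤ 1 := by
      have h : i + 1 ≤ 2 ^ j := by have := Nat.one_le_two_pow (n := j); omega
      have h' : (i:ℝ) + 1 ≤ 2 ^ j := by exact_mod_cast h
      rw [one_div_pow, ← add_div, div_le_one hpow]; exact h'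
    have hs : (i:ℝ) / 2 ^ j ∈ Icc (0:ℝ) 1 := ⟨hi0, by linarith⟩
    have hs' : (i:ℝ) / 2 ^ j + δ j / 2 ∈ Icc (0:ℝ) 1 :=
      ⟨by linarith [hdp j], by linarith [hdp j, hd1 j]⟩
    obtain ⟨γ, hγ⟩ := upper (hfc j hj1) (hfrange j hj1) ((1/2:ℝ)^j) p q hp hq _ (δ j / 2)
      (half_pos (hdp j)) hs hs' (fun t ht => hfmid j hj1 i hi1 hi2 t
        ⟨hs.1.trans ht.1, ht.2.trans hs'.2⟩ (by
          rw [abs_of_nonneg (by linarith [ht.1])]; linarith [ht.2])) hi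
    have hup := (nullDist_le γ).trans hγ
    have hlo : max |p.1 - q.1| (dist p.2 q.2 + |p.1 - q.1| / 2) - (1/2:ℝ)^j ≤
        nullDist (tWarp (f j)) (fun p => p.1) 0 1 p q := by
      refine le_csInf ⟨nullLength (fun p => p.1) γ, γ, rfl⟩ ?_
      rintro _ ⟨γ', rfl⟩
      exact lower (hfc j hj1) (hfrange j hj1) _
        (integral_small j (δ j) (hδ j) (hfc j hj1) (hfrange j hj1) (hfout j hj1)) γ'
    rw [limitDist_eq, abs_le]
    constructor <;> linarith
  · intro i m hi1 hi2
    apply tendsto_const_nhds.congr'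
    filter_upwards [eventually_ge_atTop (max m 1)] with j hj
    have hjm : m ≤ j := (le_max_left _ _).trans hj
    have hj1 : 1 ≤ j := (le_max_right _ _).trans hj
    obtain ⟨k, rfl⟩ := Nat.exists_eq_add_of_le hjm
    have hk : 1 ≤ 2 ^ k := Nat.one_le_two_pow
    have hm : 1 ≤ 2 ^ m := Nat.one_le_two_pow
    have hlt : i < 2 ^ m := by omega
    have hlt2 : i * 2 ^ k < 2 ^ (m + k) := by
      rw [pow_add]; exact Nat.mul_lt_mul_of_pos_right hlt (by omega)
    have hpow : (0:ℝ) < 2 ^ m := by positivity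
    have hlt' : (i:ℝ) < 2 ^ m := by exact_mod_cast hlt
    have e : ((i * 2 ^ k : ℕ) : ℝ) / 2 ^ (m + k) = (i:ℝ) / 2 ^ m := by
      push_cast; rw [pow_add]; field_simp
    refine (hfmid (m + k) hj1 (i * 2 ^ k) (Nat.one_le_iff_ne_zero.2 (by positivity)) (by omega) _
      ⟨by positivity, (div_le_one hpow).2 hlt'.le⟩ ?_).symm
    rw [e, sub_self, abs_zero]
    exact (half_pos (hdp _)).le
  · have hmem : (EuclideanSpace.single (⟨0, hn⟩ : Fin n) (1:ℝ)) ∈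
        Metric.closedBall (0 : EuclideanSpace ℝ (Fin n)) 1 := by simp
    let o : Disk n := ⟨0, by simp⟩
    let e : Disk n := ⟨_, hmem⟩
    have hoe : dist o e = 1 := by
      rw [Subtype.dist_eq]; simp [o, e]
    refine ⟨(0, o), (1, e), by simp, by simp, ?_⟩
    have hc : CausallyRelated (tWarp fun _ => (1:ℝ)) ((0, o) : ℝ × Disk n) (1, e) :=
      causal_of_dist 1 (by norm_num) (by simp) (by intros; norm_num) (by simp [hoe])
    obtain ⟨γ, hγ⟩ := (Chain.refl (f := tWarp fun _ => (1:ℝ)) (p := ((0, o) : ℝ × Disk n))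
      (by simp)).exists_curve hc (by simp)
    have h1 := nullDist_le γ
    rw [← hγ] at h1
    rw [limitDist_eq]
    simp only [hoe] at h1 ⊢
    norm_num at h1 ⊢
    intro h
    rw [← h] at h1
    norm_num at h1
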